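/- arXiv:1907.05257 — 8 statements merged into one kernel-verified Lean document; each statement's English description precedes it below -/
import Mathlib

section
/- In any stick representation of a bipartite graph G, for all a, a' ∈ A and b, b' ∈ B: if ab' and a'b are edges of G and x(b') ≤ x(b) ≤ x(a) ≤ x(a'), then ab is an edge of G. (Equivalently, there is no stick representation containing the configuration x(b') < x(b) < x(a) < x(a') with edges ab' and a'b but with a and b non-adjacent.) -/
open Sum

/-- A stick representation of a bipartite graph with vertex classes `A`
(vertical sticks) and `B` (horizontal sticks), edge relation `E`,
foot coordinates `x` and stick lengths `ℓ`. -/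
def IsStickRep {A B : Type*} (E : A → B → Prop)
    (x ℓ : A ⊕ B → ℝ) : Prop :=
  (∀ v, 0 < ℓ v) ∧ Function.Injective x ∧
    ∀ a b, E a b ↔
      0 ≤ x (inl a) - x (inr b) ∧
        x (inl a) - x (inr b) ≤ min (ℓ (inl a)) (ℓ (inr b))

/-- If `a b'` and `a' b` are edges and `x(b') ≤ x(b) ≤ x(a) ≤ x(a')`, then
`a b` is an edge: no stick representation contains the forbidden configuration. -/
theorem stick_rep_no_forbidden_configuration {A B : Type*} (E : A → B → Prop)
    (x ℓ : A ⊕ B → ℝ) (h : IsStickRep E x ℓ)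
    (a a' : A) (b b' : B) (hab' : E a b') (ha'b : E a' b)
    (h1 : x (inr b') ≤ x (inr b)) (h2 : x (inr b) ≤ x (inl a))
    (h3 : x (inl a) ≤ x (inl a')) :
    E a b := by
  obtain ⟨-, -, hE⟩ := h
  rw [hE, le_min_iff] at hab' ha'b ⊢
  obtain ⟨-, ha, -⟩ := hab'
  obtain ⟨-, -, hb⟩ := ha'b
  exact ⟨by linarith, by linarith, by linarith⟩
end

section
/- Let G be a bipartite graph with vertex classes A and B, and let σ_A = (a_1, …, a_m) and σ_B = (b_1, …, b_k) be enumerations of A and B. If (x₁, ℓ₁) and (x₂, ℓ₂) are two stick representations of G that both respect σ_A and σ_B, then for every non-isolated a ∈ A and every non-isolated b ∈ B one has x₁(a) < x₁(b) if and only if x₂(a) < x₂(b); that is, the order of the non-isolated vertices of A ∪ B along the ground line is the same in all stick representations respecting σ_A and σ_B. -/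
open Sum

/-- A stick representation respects the enumerations `σ_A` and `σ_B` if the foot
coordinates are strictly increasing along each enumeration. -/
def RespectsOrders {m k : ℕ} (x : Fin m ⊕ Fin k → ℝ) : Prop :=
  StrictMono (fun i : Fin m => x (inl i)) ∧ StrictMono (fun j : Fin k => x (inr j))

/-- If a non-isolated `a` lies left of a non-isolated `b` in one representation respecting the
enumerations, then the same holds in any other one: otherwise neighbors of `a` and `b` would
force `a` and `b` to be adjacent. -/
theorem IsStickRep.lt_of_lt {m k : ℕ} {E : Fin m → Fin k → Prop}
    {x ℓ y r : Fin m ⊕ Fin k → ℝ} (hx : IsStickRep E x ℓ) (hy : IsStickRep E y r)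
    (hox : RespectsOrders x) (hoy : RespectsOrders y) {a : Fin m} {b : Fin k}
    (ha : ∃ b', E a b') (hb : ∃ a', E a' b) (h : x (inl a) < x (inr b)) :
    y (inl a) < y (inr b) := by
  obtain ⟨b', hab'⟩ := ha
  obtain ⟨a', ha'b⟩ := hb
  by_contra! hle
  have hx₁ := ((hx.2.2 a b').1 hab').1
  have hx₂ := ((hx.2.2 a' b).1 ha'b).1
  have hb' : b' < b := hox.2.lt_iff_lt.1 (show x (inr b') < x (inr b) by linarith)
  have ha' : a < a' := hox.1.lt_iff_lt.1 (show x (inl a) < x (inl a') by linarith)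
  have hyb : y (inr b') < y (inr b) := hoy.2 hb'
  have hya : y (inl a) < y (inl a') := hoy.1 ha'
  have hy₁ := le_min_iff.1 ((hy.2.2 a b').1 hab').2
  have hy₂ := le_min_iff.1 ((hy.2.2 a' b).1 ha'b).2
  have hab : E a b := (hy.2.2 a b).2
    ⟨by linarith, le_min (by linarith [hy₁.1]) (by linarith [hy₂.2])⟩
  linarith [((hx.2.2 a b).1 hab).1]

/-- In all stick representations respecting `σ_A` and `σ_B`, the order of the
non-isolated vertices of `A ∪ B` on the ground line is the same. -/
theorem stickAB_order_unique {m k : ℕ} (E : Fin m → Fin k → Prop)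
    (x₁ ℓ₁ x₂ ℓ₂ : Fin m ⊕ Fin k → ℝ)
    (h₁ : IsStickRep E x₁ ℓ₁) (h₂ : IsStickRep E x₂ ℓ₂)
    (ho₁ : RespectsOrders x₁) (ho₂ : RespectsOrders x₂)
    (a : Fin m) (b : Fin k)
    (ha : ∃ b', E a b') (hb : ∃ a', E a' b) :
    (x₁ (inl a) < x₁ (inr b) ↔ x₂ (inl a) < x₂ (inr b)) := by
  exact ⟨h₁.lt_of_lt h₂ ho₁ ho₂ ha hb, h₂.lt_of_lt h₁ ho₂ ho₁ ha hb⟩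
end

section
/- Let G be a bipartite graph with vertex classes A and B and enumerations σ_A = (a_1, …, a_m) of A and σ_B = (b_1, …, b_k) of B. Then G admits a stick representation respecting σ_A and σ_B if and only if there do NOT exist indices i, g, h ∈ {1, …, m} and j, l, p ∈ {1, …, k} with g ≤ i < h and j < l ≤ p such that a_i b_j is an edge, a_h b_l is an edge, a_g b_p is an edge, and a_i b_l is not an edge of G. -/
open Sum

/-- A length that reaches every point of a finite family marked by `p`, and reaches no other point
at positive distance unless some marked point is at least as far away. -/
theorem exists_pos_length {ι : Type*} [Finite ι] (d : ι → ℝ) (p : ι → Prop)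
    (hp : ∀ i, p i → 0 < d i) :
    ∃ r, 0 < r ∧ (∀ i, p i → d i ≤ r) ∧
      ∀ i, 0 < d i → d i ≤ r → ∃ j, p j ∧ d i ≤ d j := by
  by_cases hne : {i | p i}.Nonempty
  · obtain ⟨j, hj, hmax⟩ := Set.exists_max_image {i | p i} d (Set.toFinite _) hne
    exact ⟨d j, hp j hj, hmax, fun i _ hi => ⟨j, hj, hi⟩⟩
  · have hno : ∀ i, ¬ p i := fun i hi => hne ⟨i, hi⟩
    by_cases hpos : {i | 0 < d i}.Nonempty
    · obtain ⟨j, hj, hmin⟩ := Set.exists_min_image {i | 0 < d i} d (Set.toFinite _) hpos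
      refine ⟨d j / 2, half_pos hj, fun i hi => (hno i hi).elim, fun i hi hir => ?_⟩
      exact absurd (hmin i hi) (not_le.2 (hir.trans_lt (half_lt_self hj)))
    · exact ⟨1, one_pos, fun i hi => (hno i hi).elim, fun i hi => (hpos ⟨i, hi⟩).elim⟩

/-- Foot coordinates respecting both orders, where `b` lies left of `a` only when an edge
forces it to. -/
theorem exists_foot_coordinates {m k : ℕ} (E : Fin m → Fin k → Prop) :
    ∃ x : Fin m ⊕ Fin k → ℝ, Function.Injective x ∧ RespectsOrders x ∧
      ∀ i l, (x (inr l) < x (inl i) ↔ ∃ g p, g ≤ i ∧ l ≤ p ∧ E g p) := by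
  classical
  let P : Fin m → ℕ := fun i =>
    (Finset.univ.filter fun q : Fin m × Fin k => q.1 ≤ i ∧ E q.1 q.2).sup fun q => (q.2 : ℕ) + 1
  have hP : ∀ (i : Fin m) (l : Fin k), (l : ℕ) < P i ↔ ∃ g p, g ≤ i ∧ l ≤ p ∧ E g p := by
    intro i l
    simp only [P, Finset.lt_sup_iff, Finset.mem_filter, Finset.mem_univ, true_and, Prod.exists,
      Nat.lt_succ_iff, Fin.val_fin_le]
    exact exists_congr fun g => exists_congr fun p => by tauto
  have hPmono : Monotone P := fun i i' hi =>
    Finset.sup_mono fun q hq => by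
      simp only [Finset.mem_filter, Finset.mem_univ, true_and] at hq ⊢
      exact ⟨hq.1.trans hi, hq.2⟩
  let t : Fin m → ℝ := fun i => ((i : ℝ) + 1) / (m + 1)
  have hm : (0 : ℝ) < m + 1 := by positivity
  have ht0 : ∀ i, 0 < t i := fun i => by positivity
  have ht1 : ∀ i, t i < 1 := fun i => by
    have : (i : ℝ) < m := by exact_mod_cast i.isLt
    exact (div_lt_one hm).2 (by linarith)
  have htmono : StrictMono t := fun i i' hi => by
    have : (i : ℝ) < i' := by exact_mod_cast hi
    exact div_lt_div_of_pos_right (by linarith) hm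
  let x : Fin m ⊕ Fin k → ℝ := Sum.elim (fun i => P i + t i) (fun l => l + 1)
  have hlt : ∀ (i : Fin m) (l : Fin k), (l : ℕ) < P i → x (inr l) < x (inl i) := fun i l h => by
    have h' : (l : ℝ) + 1 ≤ P i := by exact_mod_cast h
    exact h'.trans_lt (lt_add_of_pos_right _ (ht0 i))
  have hgt : ∀ (i : Fin m) (l : Fin k), ¬ (l : ℕ) < P i → x (inl i) < x (inr l) := fun i l h => by
    have h' : (P i : ℝ) ≤ l := by exact_mod_cast not_lt.1 h
    exact add_lt_add_of_le_of_lt h' (ht1 i)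
  have hA : StrictMono fun i => x (inl i) := fun i i' hi =>
    add_lt_add_of_le_of_lt (Nat.cast_le.2 (hPmono hi.le)) (htmono hi)
  have hB : StrictMono fun l => x (inr l) := fun l l' hl => by
    have h' : (l : ℝ) < l' := by exact_mod_cast hl
    exact add_lt_add_left h' 1
  have hne : ∀ i l, x (inl i) ≠ x (inr l) := fun i l => by
    by_cases h : (l : ℕ) < P i
    · exact (hlt i l h).ne'
    · exact (hgt i l h).ne
  refine ⟨x, ?_, ⟨hA, hB⟩, fun i l => ?_⟩
  · rintro (i | l) (i' | l') h
    · exact congrArg inl (hA.injective h)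
    · exact (hne i l' h).elim
    · exact (hne i' l h.symm).elim
    · exact congrArg inr (hB.injective h)
  · rw [← hP]
    exact ⟨fun h => by_contra fun h' => lt_asymm h (hgt i l h'), hlt i l⟩

/-- `G` admits a stick representation respecting `σ_A` and `σ_B` iff there is no
forbidden pattern `g ≤ i < h`, `j < l ≤ p` with edges `a_i b_j`, `a_h b_l`, `a_g b_p`
and non-edge `a_i b_l`. -/
theorem stickAB_characterization {m k : ℕ} (E : Fin m → Fin k → Prop) :
    (∃ x ℓ : Fin m ⊕ Fin k → ℝ, IsStickRep E x ℓ ∧ RespectsOrders x) ↔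
    ¬ ∃ (i g h : Fin m) (j l p : Fin k),
        g ≤ i ∧ i < h ∧ j < l ∧ l ≤ p ∧
        E i j ∧ E h l ∧ E g p ∧ ¬ E i l := by
  constructor
  · rintro ⟨x, ℓ, ⟨-, -, hE⟩, hA, hB⟩ ⟨i, g, h, j, l, p, hgi, hih, hjl, hlp, hij, hhl, hgp, hil⟩
    refine hil ((hE i l).2 ?_)
    have e₁ := ((hE i j).1 hij).2.trans (min_le_left _ _)
    have e₂ := ((hE h l).1 hhl).2.trans (min_le_right _ _)
    have e₃ := ((hE g p).1 hgp).1
    have f₁ := hA.monotone hgi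
    have f₂ := hA hih
    have f₃ := hB hjl
    have f₄ := hB.monotone hlp
    simp only at f₁ f₂ f₃ f₄
    exact ⟨by linarith, le_min (by linarith) (by linarith)⟩
  · intro hno
    obtain ⟨x, hinj, ⟨hA, hB⟩, hx⟩ := exists_foot_coordinates E
    have hpos : ∀ i l, E i l → 0 < x (inl i) - x (inr l) := fun i l h =>
      sub_pos.2 ((hx i l).2 ⟨i, l, le_rfl, le_rfl, h⟩)
    choose r hr0 hr hr' using fun i =>
      exists_pos_length (fun l => x (inl i) - x (inr l)) (E i) (hpos i)
    choose s hs0 hs hs' using fun l =>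
      exists_pos_length (fun i => x (inl i) - x (inr l)) (E · l) (hpos · l)
    refine ⟨x, Sum.elim r s, ⟨?_, hinj, fun i l => ⟨fun h => ?_, fun h => ?_⟩⟩, hA, hB⟩
    · rintro (i | l)
      exacts [hr0 i, hs0 l]
    · exact ⟨(hpos i l h).le, le_min (hr i l h) (hs l i h)⟩
    · obtain ⟨h0, h1⟩ := h
      have hd : 0 < x (inl i) - x (inr l) :=
        h0.lt_of_ne' (sub_ne_zero.2 (hinj.ne (by simp)))
      by_contra hil
      obtain ⟨j, hij, hj⟩ := hr' i l hd (h1.trans (min_le_left _ _))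
      obtain ⟨h, hhl, hh⟩ := hs' l i hd (h1.trans (min_le_right _ _))
      obtain ⟨g, p, hgi, hlp, hgp⟩ := (hx i l).1 (sub_pos.1 hd)
      have hjl : j ≤ l := hB.le_iff_le.1 (sub_le_sub_iff_left _ |>.1 hj)
      have hih : i ≤ h := hA.le_iff_le.1 (sub_le_sub_iff_right _ |>.1 hh)
      refine hno ⟨i, g, h, j, l, p, hgi, hih.lt_of_ne ?_, hjl.lt_of_ne ?_, hlp, hij, hhl, hgp, hil⟩
      · rintro rfl
        exact hil hhl
      · rintro rfl
        exact hil hij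
end

section
/- For every integer n ≥ 1 and all reals ε > 0 and δ > 0, the 2n-vertex ε-path admits a stick representation whose width and height both exceed nε − δ (a maximally stretched representation). -/
/-- A stick representation of the `2n`-vertex `ε`-path: vertices are `Fin (2*n)`
(0-based; the vertex with even 0-based index, i.e. odd 1-based index, is a vertical
stick, the others are horizontal sticks), all sticks have length `ε`, consecutive
vertices are adjacent, and `x` gives the foot coordinates.  Since all lengths equal
`ε`, a vertical stick `i` and a horizontal stick `j` intersect iff
`0 ≤ x i - x j ≤ ε`. -/
def IsEpsPathRep (n : ℕ) (ε : ℝ) (x : Fin (2 * n) → ℝ) : Prop :=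
  Function.Injective x ∧
    ∀ i j : Fin (2 * n), i.val % 2 = 0 → j.val % 2 = 1 →
      ((j.val = i.val + 1 ∨ i.val = j.val + 1) ↔
        (0 ≤ x i - x j ∧ x i - x j ≤ ε))

/-- The set of x-coordinates of all points of all sticks: a vertical stick `i`
occupies the single x-coordinate `x i`, a horizontal stick `j` occupies
`[x j, x j + ε]`. -/
def xCoords (n : ℕ) (ε : ℝ) (x : Fin (2 * n) → ℝ) : Set ℝ :=
  {r | ∃ i : Fin (2 * n),
    (i.val % 2 = 0 ∧ r = x i) ∨ (i.val % 2 = 1 ∧ x i ≤ r ∧ r ≤ x i + ε)}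

/-- The set of y-coordinates of all points of all sticks: a vertical stick `i`
occupies `[-x i, -x i + ε]`, a horizontal stick `j` occupies the single
y-coordinate `-x j`. -/
def yCoords (n : ℕ) (ε : ℝ) (x : Fin (2 * n) → ℝ) : Set ℝ :=
  {r | ∃ i : Fin (2 * n),
    (i.val % 2 = 0 ∧ -x i ≤ r ∧ r ≤ -x i + ε) ∨ (i.val % 2 = 1 ∧ r = -x i)}

/-- Width of a stick representation of the `ε`-path. -/
noncomputable def widthOf (n : ℕ) (ε : ℝ) (x : Fin (2 * n) → ℝ) : ℝ :=
  sSup (xCoords n ε x) - sInf (xCoords n ε x)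

/-- Height of a stick representation of the `ε`-path. -/
noncomputable def heightOf (n : ℕ) (ε : ℝ) (x : Fin (2 * n) → ℝ) : ℝ :=
  sSup (yCoords n ε x) - sInf (yCoords n ε x)

theorem bddAbove_xCoords {n : ℕ} {ε : ℝ} (hε : 0 ≤ ε) (x : Fin (2 * n) → ℝ) :
    BddAbove (xCoords n ε x) := by
  obtain ⟨M, hM⟩ := (Set.finite_range x).bddAbove
  refine ⟨M + ε, ?_⟩
  rintro r ⟨i, hi⟩
  have := hM ⟨i, rfl⟩
  rcases hi with ⟨-, h⟩ | ⟨-, -, h⟩ <;> linarith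

theorem bddBelow_xCoords (n : ℕ) (ε : ℝ) (x : Fin (2 * n) → ℝ) :
    BddBelow (xCoords n ε x) := by
  obtain ⟨m, hm⟩ := (Set.finite_range x).bddBelow
  refine ⟨m, ?_⟩
  rintro r ⟨i, hi⟩
  have := hm ⟨i, rfl⟩
  rcases hi with ⟨-, h⟩ | ⟨-, h, -⟩ <;> linarith

theorem bddAbove_yCoords {n : ℕ} {ε : ℝ} (hε : 0 ≤ ε) (x : Fin (2 * n) → ℝ) :
    BddAbove (yCoords n ε x) := by
  obtain ⟨m, hm⟩ := (Set.finite_range x).bddBelow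
  refine ⟨-m + ε, ?_⟩
  rintro r ⟨i, hi⟩
  have := hm ⟨i, rfl⟩
  rcases hi with ⟨-, -, h⟩ | ⟨-, h⟩ <;> linarith

theorem bddBelow_yCoords (n : ℕ) (ε : ℝ) (x : Fin (2 * n) → ℝ) :
    BddBelow (yCoords n ε x) := by
  obtain ⟨M, hM⟩ := (Set.finite_range x).bddAbove
  refine ⟨-M, ?_⟩
  rintro r ⟨i, hi⟩
  have := hM ⟨i, rfl⟩
  rcases hi with ⟨-, h, -⟩ | ⟨-, h⟩ <;> linarith

theorem sub_le_widthOf {n : ℕ} {ε : ℝ} (hε : 0 ≤ ε) {x : Fin (2 * n) → ℝ} {r s : ℝ}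
    (hr : r ∈ xCoords n ε x) (hs : s ∈ xCoords n ε x) : r - s ≤ widthOf n ε x :=
  sub_le_sub (le_csSup (bddAbove_xCoords hε x) hr) (csInf_le (bddBelow_xCoords n ε x) hs)

theorem sub_le_heightOf {n : ℕ} {ε : ℝ} (hε : 0 ≤ ε) {x : Fin (2 * n) → ℝ} {r s : ℝ}
    (hr : r ∈ yCoords n ε x) (hs : s ∈ yCoords n ε x) : r - s ≤ heightOf n ε x :=
  sub_le_sub (le_csSup (bddAbove_yCoords hε x) hr) (csInf_le (bddBelow_yCoords n ε x) hs)

/-- Foot coordinates of the staircase with step `ε - η`: the `k`-th horizontal stick starts at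
`k (ε - η)`, and the `k`-th vertical stick stands `η / 2` to the right of that point. -/
noncomputable def staircase (n : ℕ) (ε η : ℝ) (i : Fin (2 * n)) : ℝ :=
  ((i.val / 2 : ℕ) : ℝ) * (ε - η) + if i.val % 2 = 0 then η / 2 else 0

theorem staircase_of_even {n : ℕ} (ε η : ℝ) {i : Fin (2 * n)} (hi : i.val % 2 = 0) :
    staircase n ε η i = ((i.val / 2 : ℕ) : ℝ) * (ε - η) + η / 2 := by
  simp [staircase, hi]

theorem staircase_of_odd {n : ℕ} (ε η : ℝ) {i : Fin (2 * n)} (hi : i.val % 2 = 1) :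
    staircase n ε η i = ((i.val / 2 : ℕ) : ℝ) * (ε - η) := by
  simp [staircase, hi]

theorem staircase_strict_of_div_lt {n : ℕ} {ε η : ℝ} (hη : 0 < η) (hηε : η ≤ ε / 2)
    {i j : Fin (2 * n)} (h : i.val / 2 < j.val / 2) :
    staircase n ε η i < staircase n ε η j := by
  have h1 : ((i.val / 2 : ℕ) : ℝ) + 1 ≤ ((j.val / 2 : ℕ) : ℝ) := by exact_mod_cast h
  have h2 := mul_le_mul_of_nonneg_right h1 (show 0 ≤ ε - η by linarith)
  unfold staircase
  split_ifs <;> linarith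

theorem staircase_injective {n : ℕ} {ε η : ℝ} (hη : 0 < η) (hηε : η ≤ ε / 2) :
    Function.Injective (staircase n ε η) := by
  intro i j hij
  have hdiv : i.val / 2 = j.val / 2 := by
    rcases lt_trichotomy (i.val / 2) (j.val / 2) with h | h | h
    · exact absurd hij (staircase_strict_of_div_lt hη hηε h).ne
    · exact h
    · exact absurd hij (staircase_strict_of_div_lt hη hηε h).ne'
  have hmod : i.val % 2 = j.val % 2 := by
    unfold staircase at hij
    rw [hdiv] at hij
    split_ifs at hij <;> first | omega | (exfalso; linarith)
  ext
  omega

theorem isEpsPathRep_staircase {n : ℕ} {ε η : ℝ} (hη : 0 < η) (hηε : η ≤ ε / 2) :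
    IsEpsPathRep n ε (staircase n ε η) := by
  refine ⟨staircase_injective hη hηε, fun i j hi hj => ?_⟩
  rw [staircase_of_even ε η hi, staircase_of_odd ε η hj]
  have hs : 0 ≤ ε - η := by linarith
  constructor
  · rintro (h | h)
    · rw [show j.val / 2 = i.val / 2 by omega]
      constructor <;> linarith
    · rw [show i.val / 2 = j.val / 2 + 1 by omega]
      push_cast
      constructor <;> linarith
  · rintro ⟨h1, h2⟩
    by_contra hne
    have : i.val / 2 + 1 ≤ j.val / 2 ∨ j.val / 2 + 2 ≤ i.val / 2 := by omega
    rcases this with h | h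
    · have h3 : ((i.val / 2 : ℕ) : ℝ) + 1 ≤ ((j.val / 2 : ℕ) : ℝ) := by exact_mod_cast h
      have h4 := mul_le_mul_of_nonneg_right h3 hs
      linarith
    · have h3 : ((j.val / 2 : ℕ) : ℝ) + 2 ≤ ((i.val / 2 : ℕ) : ℝ) := by exact_mod_cast h
      have h4 := mul_le_mul_of_nonneg_right h3 hs
      linarith

/-- The `2n`-vertex `ε`-path admits a stick representation whose width and height
both exceed `n·ε − δ` (a maximally stretched representation). -/
theorem epsPath_stretched_representation (n : ℕ) (hn : 1 ≤ n) (ε δ : ℝ)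
    (hε : 0 < ε) (hδ : 0 < δ) :
    ∃ x : Fin (2 * n) → ℝ, IsEpsPathRep n ε x ∧
      (n : ℝ) * ε - δ < widthOf n ε x ∧ (n : ℝ) * ε - δ < heightOf n ε x := by
  have hn0 : (0 : ℝ) < n := by exact_mod_cast hn
  obtain ⟨η, hη, hηε, hηδ⟩ : ∃ η : ℝ, 0 < η ∧ η ≤ ε / 2 ∧ n * η ≤ δ := by
    refine ⟨min (ε / 2) (δ / n), by positivity, min_le_left _ _, ?_⟩
    rw [mul_comm, ← le_div_iff₀ hn0]
    exact min_le_right _ _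
  let first : Fin (2 * n) := ⟨0, by omega⟩
  let second : Fin (2 * n) := ⟨1, by omega⟩
  let last : Fin (2 * n) := ⟨2 * n - 1, by omega⟩
  have hlast_odd : last.val % 2 = 1 := by simp only [last]; omega
  have hx_first : staircase n ε η first = η / 2 := by simp [staircase, first]
  have hx_second : staircase n ε η second = 0 := by simp [staircase, second]
  have hx_last : staircase n ε η last = ((n : ℝ) - 1) * (ε - η) := by
    rw [staircase_of_odd ε η hlast_odd, show last.val / 2 = n - 1 by simp only [last]; omega,
      Nat.cast_sub hn, Nat.cast_one]
  refine ⟨staircase n ε η, isEpsPathRep_staircase hη hηε, ?_, ?_⟩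
  · have := sub_le_widthOf hε.le (x := staircase n ε η) (r := staircase n ε η last + ε)
      (s := staircase n ε η second) ⟨last, .inr ⟨hlast_odd, by linarith, le_rfl⟩⟩
      ⟨second, .inr ⟨rfl, le_rfl, by linarith⟩⟩
    rw [hx_last, hx_second] at this
    linarith
  · have := sub_le_heightOf hε.le (x := staircase n ε η) (r := -staircase n ε η first + ε)
      (s := -staircase n ε η last) ⟨first, .inl ⟨rfl, by linarith, le_rfl⟩⟩
      ⟨last, .inr ⟨hlast_odd, rfl⟩⟩
    rw [hx_last, hx_first] at this
    linarith
end

section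
/- For every integer n ≥ 3 and all reals ε > 0 and δ > 0, the 2n-vertex ε-path admits a stick representation whose width and height are both at most ((n+2)/3)·ε + δ (a maximally compressed representation). -/
/-- Equally spaced feet: horizontal sticks at multiples of `ε / 3 + η`, and vertical sticks at
distance `η` to the left of such multiples. -/
noncomputable def equispacedFoot (ε η : ℝ) (v : ℕ) : ℝ :=
  if v % 2 = 0 then (((v / 2 : ℕ) : ℝ) + 1) * (ε / 3 + η) - η
  else ((v / 2 : ℕ) : ℝ) * (ε / 3 + η)

theorem equispacedFoot_of_even {ε η : ℝ} {v : ℕ} (hv : v % 2 = 0) :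
    equispacedFoot ε η v = (((v / 2 : ℕ) : ℝ) + 1) * (ε / 3 + η) - η := by
  simp [equispacedFoot, hv]

theorem equispacedFoot_of_odd {ε η : ℝ} {v : ℕ} (hv : v % 2 = 1) :
    equispacedFoot ε η v = ((v / 2 : ℕ) : ℝ) * (ε / 3 + η) := by
  simp [equispacedFoot, hv]

/-- The foot-distance condition for intersection holds exactly for consecutive vertices. -/
theorem equispacedFoot_adj_iff {ε η : ℝ} (hε : 0 < ε) (hη : 0 < η) (hηε : η ≤ ε / 3) {i j : ℕ}
    (hi : i % 2 = 0) (hj : j % 2 = 1) :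
    (j = i + 1 ∨ i = j + 1) ↔
      (0 ≤ equispacedFoot ε η i - equispacedFoot ε η j ∧
        equispacedFoot ε η i - equispacedFoot ε η j ≤ ε) := by
  rw [equispacedFoot_of_even hi, equispacedFoot_of_odd hj]
  have hg : 0 < ε / 3 + η := by positivity
  have hdiv : (j = i + 1 ∨ i = j + 1) ↔ (i / 2 = j / 2 ∨ i / 2 = j / 2 + 1) := by omega
  rw [hdiv]
  generalize i / 2 = k
  generalize j / 2 = l
  constructor
  · rintro (rfl | rfl)
    · constructor <;> linarith
    · push_cast
      constructor <;> linarith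
  · rintro ⟨h₁, h₂⟩
    by_contra! hne
    rcases lt_or_ge k l with hkl | hkl
    · have hkl' : (k : ℝ) + 1 ≤ l := by exact_mod_cast hkl
      nlinarith [mul_le_mul_of_nonneg_right hkl' hg.le]
    · have hkl' : (l : ℝ) + 2 ≤ k := by
        have : l + 2 ≤ k := by omega
        exact_mod_cast this
      nlinarith [mul_le_mul_of_nonneg_right hkl' hg.le]

theorem equispacedFoot_even_ne_odd {ε η : ℝ} (hε : 0 < ε) (hη : 0 < η) {i j : ℕ}
    (hi : i % 2 = 0) (hj : j % 2 = 1) : equispacedFoot ε η i ≠ equispacedFoot ε η j := by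
  rw [equispacedFoot_of_even hi, equispacedFoot_of_odd hj]
  have hg : 0 < ε / 3 + η := by positivity
  generalize i / 2 = k
  generalize j / 2 = l
  intro h
  rcases lt_or_ge k l with hkl | hkl
  · have hkl' : (k : ℝ) + 1 ≤ l := by exact_mod_cast hkl
    nlinarith [mul_le_mul_of_nonneg_right hkl' hg.le]
  · have hkl' : (l : ℝ) ≤ k := by exact_mod_cast hkl
    nlinarith [mul_le_mul_of_nonneg_right hkl' hg.le]

theorem equispacedFoot_injective {ε η : ℝ} (hε : 0 < ε) (hη : 0 < η) :
    Function.Injective (equispacedFoot ε η) := by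
  intro i j h
  have hg : ε / 3 + η ≠ 0 := by positivity
  rcases Nat.mod_two_eq_zero_or_one i with hi | hi <;>
    rcases Nat.mod_two_eq_zero_or_one j with hj | hj
  · rw [equispacedFoot_of_even hi, equispacedFoot_of_even hj] at h
    have h' := add_right_cancel (mul_right_cancel₀ hg (sub_left_injective h))
    have : i / 2 = j / 2 := by exact_mod_cast h'
    omega
  · exact absurd h (equispacedFoot_even_ne_odd hε hη hi hj)
  · exact absurd h.symm (equispacedFoot_even_ne_odd hε hη hj hi)
  · rw [equispacedFoot_of_odd hi, equispacedFoot_of_odd hj] at h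
    have h' := mul_right_cancel₀ hg h
    have : i / 2 = j / 2 := by exact_mod_cast h'
    omega

theorem csSup_sub_csInf_le_of_subset_Icc {s : Set ℝ} {a b : ℝ} (hs : s.Nonempty)
    (h : s ⊆ Set.Icc a b) : sSup s - sInf s ≤ b - a :=
  sub_le_sub (csSup_le hs fun _ hr => (h hr).2) (le_csInf hs fun _ hr => (h hr).1)

/-- For `n ≥ 3`, the `2n`-vertex `ε`-path admits a stick representation whose width
and height are both at most `((n+2)/3)·ε + δ` (a maximally compressed
representation). -/
theorem epsPath_compressed_representation (n : ℕ) (hn : 3 ≤ n) (ε δ : ℝ)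
    (hε : 0 < ε) (hδ : 0 < δ) :
    ∃ x : Fin (2 * n) → ℝ, IsEpsPathRep n ε x ∧
      widthOf n ε x ≤ ((n : ℝ) + 2) / 3 * ε + δ ∧
      heightOf n ε x ≤ ((n : ℝ) + 2) / 3 * ε + δ := by
  have hn₀ : (0 : ℝ) < n := by
    have : 0 < n := by omega
    exact_mod_cast this
  obtain ⟨η, hη, hηε, hηδ⟩ : ∃ η : ℝ, 0 < η ∧ η ≤ ε / 3 ∧ n * η ≤ δ := by
    refine ⟨min (ε / 3) (δ / n), by positivity, min_le_left _ _, ?_⟩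
    rw [mul_comm, ← le_div_iff₀ hn₀]
    exact min_le_right _ _
  have hg : 0 < ε / 3 + η := by positivity
  have hindex (i : Fin (2 * n)) : 0 ≤ (((i : ℕ) / 2 : ℕ) : ℝ) * (ε / 3 + η) ∧
      (((i : ℕ) / 2 : ℕ) : ℝ) * (ε / 3 + η) ≤ (n - 1) * (ε / 3 + η) := by
    refine ⟨by positivity, mul_le_mul_of_nonneg_right ?_ hg.le⟩
    have : (i : ℕ) / 2 + 1 ≤ n := by omega
    rw [le_sub_iff_add_le]
    exact_mod_cast this
  have hbound : ((n : ℝ) - 1) * (ε / 3 + η) + ε ≤ ((n : ℝ) + 2) / 3 * ε + δ := by linarith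
  refine ⟨fun i => equispacedFoot ε η i,
    ⟨(equispacedFoot_injective hε hη).comp Fin.val_injective,
      fun i j hi hj => equispacedFoot_adj_iff hε hη hηε hi hj⟩, ?_, ?_⟩
  · have hne : (xCoords n ε fun i => equispacedFoot ε η i).Nonempty :=
      ⟨_, ⟨0, by omega⟩, Or.inl ⟨rfl, rfl⟩⟩
    refine (csSup_sub_csInf_le_of_subset_Icc (a := 0) (b := (n - 1) * (ε / 3 + η) + ε)
      hne ?_).trans (by linarith)
    rintro r ⟨i, ⟨hi, rfl⟩ | ⟨hi, h₁, h₂⟩⟩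
    · obtain ⟨h₃, h₄⟩ := hindex i
      simp only [equispacedFoot_of_even hi]
      constructor <;> linarith
    · obtain ⟨h₃, h₄⟩ := hindex i
      simp only [equispacedFoot_of_odd hi] at h₁ h₂
      constructor <;> linarith
  · have hne : (yCoords n ε fun i => equispacedFoot ε η i).Nonempty :=
      ⟨_, ⟨1, by omega⟩, Or.inr ⟨rfl, rfl⟩⟩
    refine (csSup_sub_csInf_le_of_subset_Icc (a := -((n - 1) * (ε / 3 + η) + ε / 3))
      (b := 2 * ε / 3) hne ?_).trans (by linarith)
    rintro r ⟨i, ⟨hi, h₁, h₂⟩ | ⟨hi, rfl⟩⟩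
    · obtain ⟨h₃, h₄⟩ := hindex i
      simp only [equispacedFoot_of_even hi] at h₁ h₂
      constructor <;> linarith
    · obtain ⟨h₃, h₄⟩ := hindex i
      simp only [equispacedFoot_of_odd hi]
      constructor <;> linarith
end

section
/- For every integer n ≥ 1 and every real ε > 0, every stick representation of the 2n-vertex ε-path has width at most nε and height at most nε. -/
/-- In a representation of the `ε`-path, feet of consecutive vertices are at distance at most `ε`,
with the vertical (even) stick to the right of the horizontal (odd) one. -/
lemma IsEpsPathRep.adj_bounds {n : ℕ} {ε : ℝ} {x : Fin (2 * n) → ℝ} (hx : IsEpsPathRep n ε x)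
    {i j : Fin (2 * n)} (hi : i.val % 2 = 0) (hij : j.val = i.val + 1 ∨ i.val = j.val + 1) :
    x j ≤ x i ∧ x i ≤ x j + ε := by
  have h := (hx.2 i j hi (by omega)).1 hij
  constructor <;> linarith [h.1, h.2]

lemma IsEpsPathRep.abs_sub_le_of_add_two {n : ℕ} {ε : ℝ} {x : Fin (2 * n) → ℝ}
    (hx : IsEpsPathRep n ε x) {i j : Fin (2 * n)} (hij : j.val = i.val + 2) :
    |x i - x j| ≤ ε := by
  let m : Fin (2 * n) := ⟨i.val + 1, by omega⟩
  have hm : m.val = i.val + 1 := rfl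
  rw [abs_le]
  rcases Nat.mod_two_eq_zero_or_one i.val with hi | hi
  · have h₁ := hx.adj_bounds (i := i) (j := m) hi (by omega)
    have h₂ := hx.adj_bounds (i := j) (j := m) (by omega) (by omega)
    constructor <;> linarith [h₁.1, h₁.2, h₂.1, h₂.2]
  · have h₁ := hx.adj_bounds (i := m) (j := i) (by omega) (by omega)
    have h₂ := hx.adj_bounds (i := m) (j := j) (by omega) (by omega)
    constructor <;> linarith [h₁.1, h₁.2, h₂.1, h₂.2]

lemma IsEpsPathRep.abs_sub_le_of_add_two_mul {n : ℕ} {ε : ℝ} {x : Fin (2 * n) → ℝ}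
    (hx : IsEpsPathRep n ε x) (k : ℕ) {i j : Fin (2 * n)} (hij : j.val = i.val + 2 * k) :
    |x i - x j| ≤ k * ε := by
  induction k generalizing j with
  | zero =>
    obtain rfl : j = i := Fin.ext (by omega)
    simp
  | succ k ih =>
    let m : Fin (2 * n) := ⟨i.val + 2 * k, by omega⟩
    have hm : m.val = i.val + 2 * k := rfl
    have h₁ := ih hm
    have h₂ := hx.abs_sub_le_of_add_two (i := m) (j := j) (by omega)
    push_cast
    linarith [abs_sub_le (x i) (x m) (x j)]

/-- Feet of sticks of the same orientation differ by at most `(n - 1) * ε`. -/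
lemma IsEpsPathRep.sub_add_le {n : ℕ} {ε : ℝ} (hε : 0 < ε) {x : Fin (2 * n) → ℝ}
    (hx : IsEpsPathRep n ε x) {i j : Fin (2 * n)} (hij : i.val % 2 = j.val % 2) :
    x i - x j + ε ≤ n * ε := by
  obtain ⟨k, hkn, h⟩ : ∃ k : ℕ, k + 1 ≤ n ∧ |x i - x j| ≤ k * ε := by
    rcases le_total i.val j.val with hle | hle
    · exact ⟨(j.val - i.val) / 2, by omega, hx.abs_sub_le_of_add_two_mul _ (by omega)⟩
    · exact ⟨(i.val - j.val) / 2, by omega,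
        abs_sub_comm (x i) (x j) ▸ hx.abs_sub_le_of_add_two_mul _ (by omega)⟩
  have hkn' : (k : ℝ) + 1 ≤ n := by exact_mod_cast hkn
  calc x i - x j + ε ≤ (k + 1) * ε := by linarith [le_abs_self (x i - x j)]
    _ ≤ n * ε := by gcongr

lemma IsEpsPathRep.exists_odd_of_mem_xCoords {n : ℕ} {ε : ℝ} {x : Fin (2 * n) → ℝ}
    (hx : IsEpsPathRep n ε x) {r : ℝ} (hr : r ∈ xCoords n ε x) :
    ∃ j : Fin (2 * n), j.val % 2 = 1 ∧ x j ≤ r ∧ r ≤ x j + ε := by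
  obtain ⟨i, ⟨hi, rfl⟩ | h⟩ := hr
  · exact ⟨⟨i.val + 1, by omega⟩, by simp only; omega, hx.adj_bounds hi (Or.inl rfl)⟩
  · exact ⟨i, h⟩

lemma IsEpsPathRep.exists_even_of_mem_yCoords {n : ℕ} {ε : ℝ} {x : Fin (2 * n) → ℝ}
    (hx : IsEpsPathRep n ε x) {r : ℝ} (hr : r ∈ yCoords n ε x) :
    ∃ i : Fin (2 * n), i.val % 2 = 0 ∧ -x i ≤ r ∧ r ≤ -x i + ε := by
  obtain ⟨j, h | ⟨hj, rfl⟩⟩ := hr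
  · exact ⟨j, h⟩
  · let i : Fin (2 * n) := ⟨j.val - 1, by omega⟩
    have hi : i.val = j.val - 1 := rfl
    have h := hx.adj_bounds (i := i) (j := j) (by omega) (by omega)
    exact ⟨i, by omega, by linarith [h.1], by linarith [h.2]⟩

lemma Real.sSup_sub_sInf_le {s : Set ℝ} (hs : s.Nonempty) {c : ℝ}
    (h : ∀ a ∈ s, ∀ b ∈ s, a - b ≤ c) : sSup s - sInf s ≤ c := by
  have : sSup s ≤ sInf s + c := csSup_le hs fun a ha => by
    linarith [le_csInf hs fun b hb => show a - c ≤ b by linarith [h a ha b hb]]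
  linarith

/-- Every stick representation of the `2n`-vertex `ε`-path has width at most `n·ε`
and height at most `n·ε`. -/
theorem epsPath_width_height_upper_bound (n : ℕ) (hn : 1 ≤ n) (ε : ℝ) (hε : 0 < ε)
    (x : Fin (2 * n) → ℝ) (hx : IsEpsPathRep n ε x) :
    widthOf n ε x ≤ (n : ℝ) * ε ∧ heightOf n ε x ≤ (n : ℝ) * ε := by
  let i₀ : Fin (2 * n) := ⟨0, by omega⟩
  constructor
  · refine Real.sSup_sub_sInf_le (s := xCoords n ε x) ⟨x i₀, i₀, Or.inl ⟨rfl, rfl⟩⟩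
      fun a ha b hb => ?_
    obtain ⟨i, hi, -, hai⟩ := hx.exists_odd_of_mem_xCoords ha
    obtain ⟨j, hj, hbj, -⟩ := hx.exists_odd_of_mem_xCoords hb
    linarith [hx.sub_add_le hε (hi.trans hj.symm)]
  · refine Real.sSup_sub_sInf_le (s := yCoords n ε x)
      ⟨-x i₀, i₀, Or.inl ⟨rfl, le_rfl, by linarith⟩⟩ fun a ha b hb => ?_
    obtain ⟨i, hi, -, hai⟩ := hx.exists_even_of_mem_yCoords ha
    obtain ⟨j, hj, hbj, -⟩ := hx.exists_even_of_mem_yCoords hb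
    linarith [hx.sub_add_le hε (hj.trans hi.symm)]
end

section
/- For every integer n ≥ 1 and every real ε > 0, every stick representation of the 2n-vertex ε-path has width strictly greater than nε/3 and height strictly greater than nε/3. -/
theorem IsEpsPathRep.lt_of_four_odd {n : ℕ} {ε : ℝ} {x : Fin (2 * n) → ℝ}
    (hx : IsEpsPathRep n ε x) {i j k l : Fin (2 * n)}
    (hi : i.val % 2 = 1) (hj : j.val % 2 = 1) (hk : k.val % 2 = 1) (hl : l.val % 2 = 1)
    (hij : x i < x j) (hjk : x j < x k) (hkl : x k < x l) : ε < x l - x i := by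
  by_contra! hle
  have adj := hx.2
  have ne_of_lt {u v : Fin (2 * n)} (h : x u < x v) : u.val ≠ v.val := by
    intro huv
    rw [Fin.ext huv] at h
    exact lt_irrefl _ h
  have nij := ne_of_lt hij
  have njk := ne_of_lt hjk
  have nkl := ne_of_lt hkl
  have nik := ne_of_lt (hij.trans hjk)
  have njl := ne_of_lt (hjk.trans hkl)
  have adj_i {a : Fin (2 * n)} (ha : a.val % 2 = 0)
      (haj : j.val = a.val + 1 ∨ a.val = j.val + 1) :
      i.val = a.val + 1 ∨ a.val = i.val + 1 := by
    obtain ⟨h1, h2⟩ := (adj a j ha hj).1 haj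
    rcases le_or_gt (x a) (x i + ε) with h | h
    · exact (adj a i ha hi).2 ⟨by linarith, by linarith⟩
    · have e1 := (adj a k ha hk).2 ⟨by linarith, by linarith⟩
      have e2 := (adj a l ha hl).2 ⟨by linarith, by linarith⟩
      omega
  have adj_l {a : Fin (2 * n)} (ha : a.val % 2 = 0)
      (hak : k.val = a.val + 1 ∨ a.val = k.val + 1) :
      l.val = a.val + 1 ∨ a.val = l.val + 1 := by
    obtain ⟨h1, h2⟩ := (adj a k ha hk).1 hak
    rcases le_or_gt (x a) (x i + ε) with h | h
    · have e1 := (adj a i ha hi).2 ⟨by linarith, by linarith⟩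
      have e2 := (adj a j ha hj).2 ⟨by linarith, by linarith⟩
      omega
    · exact (adj a l ha hl).2 ⟨by linarith, by linarith⟩
  have last_j : j.val + 1 = 2 * n := by
    by_contra hne
    have e1 := adj_i (a := ⟨j.val - 1, by omega⟩) (by simp only; omega) (by grind)
    have e2 := adj_i (a := ⟨j.val + 1, by omega⟩) (by simp only; omega) (by grind)
    simp only at e1 e2
    omega
  have last_k : k.val + 1 = 2 * n := by
    by_contra hne
    have e1 := adj_l (a := ⟨k.val - 1, by omega⟩) (by simp only; omega) (by grind)
    have e2 := adj_l (a := ⟨k.val + 1, by omega⟩) (by simp only; omega) (by grind)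
    simp only at e1 e2
    omega
  omega

theorem exists_lt_sub_of_four_spread {S : Finset ℝ} (hS : S.Nonempty) {ε : ℝ} (hε : 0 < ε)
    (h : ∀ i ∈ S, ∀ j ∈ S, ∀ k ∈ S, ∀ l ∈ S, i < j → j < k → k < l → ε < l - i) :
    ∃ p ∈ S, ∃ q ∈ S, (S.card : ℝ) * ε / 3 < q + ε - p := by
  obtain ⟨n, hn⟩ : ∃ n, S.card = n := ⟨_, rfl⟩
  have hpos : 0 < n := hn ▸ hS.card_pos
  let f := S.orderEmbOfFin hn
  have mem (i) : f i ∈ S := S.orderEmbOfFin_mem hn i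
  have mono {i j : Fin n} (hij : i.val < j.val) : f i < f j := f.strictMono hij
  have spread (m : ℕ) (hm : 3 * m < n) : f ⟨0, hpos⟩ + m * ε ≤ f ⟨3 * m, hm⟩ := by
    induction m with
    | zero => simp
    | succ m ih =>
      have := ih (by omega)
      have := h _ (mem ⟨3 * m, by omega⟩) _ (mem ⟨3 * m + 1, by omega⟩)
        _ (mem ⟨3 * m + 2, by omega⟩) _ (mem ⟨3 * (m + 1), hm⟩)
        (mono (by simp)) (mono (by simp)) (mono (by simp only; omega))
      push_cast
      linarith
  obtain ⟨m, hm⟩ : ∃ m, n = 3 * m + 1 ∨ n = 3 * m + 2 ∨ n = 3 * m + 3 :=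
    ⟨(n - 1) / 3, by omega⟩
  have hm0 := spread m (by omega)
  rw [hn]
  by_cases h3 : n = 3 * m + 3
  · refine ⟨_, mem ⟨0, hpos⟩, _, mem ⟨3 * m + 1, by omega⟩, ?_⟩
    have := mono (i := ⟨3 * m, by omega⟩) (j := ⟨3 * m + 1, by omega⟩) (by simp)
    have hc : (n : ℝ) = 3 * m + 3 := by exact_mod_cast h3
    rw [hc]
    linarith
  · refine ⟨_, mem ⟨0, hpos⟩, _, mem ⟨3 * m, by omega⟩, ?_⟩
    have hc : (n : ℝ) ≤ 3 * m + 2 := by exact_mod_cast (by omega : n ≤ 3 * m + 2)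
    have := mul_le_mul_of_nonneg_right hc hε.le
    linarith

theorem le_widthOf {n : ℕ} {ε : ℝ} (hε : 0 < ε) (x : Fin (2 * n) → ℝ) {p q : Fin (2 * n)}
    (hp : p.val % 2 = 1) (hq : q.val % 2 = 1) : x q + ε - x p ≤ widthOf n ε x := by
  obtain ⟨M, hM⟩ := (Set.finite_range x).bddAbove
  obtain ⟨m, hm⟩ := (Set.finite_range x).bddBelow
  have habove : BddAbove (xCoords n ε x) := by
    refine ⟨M + ε, ?_⟩
    rintro r ⟨i, hi⟩
    have := hM ⟨i, rfl⟩
    rcases hi with hi | hi <;> linarith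
  have hbelow : BddBelow (xCoords n ε x) := by
    refine ⟨m, ?_⟩
    rintro r ⟨i, hi⟩
    have := hm ⟨i, rfl⟩
    rcases hi with hi | hi <;> linarith
  have h1 : x q + ε ≤ sSup (xCoords n ε x) :=
    le_csSup habove ⟨q, Or.inr ⟨hq, by linarith, le_rfl⟩⟩
  have h2 : sInf (xCoords n ε x) ≤ x p :=
    csInf_le hbelow ⟨p, Or.inr ⟨hp, le_rfl, by linarith⟩⟩
  unfold widthOf
  linarith

theorem IsEpsPathRep.lt_widthOf {n : ℕ} (hn : 1 ≤ n) {ε : ℝ} (hε : 0 < ε)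
    {x : Fin (2 * n) → ℝ} (hx : IsEpsPathRep n ε x) : (n : ℝ) * ε / 3 < widthOf n ε x := by
  let o : Fin n → Fin (2 * n) := fun j => ⟨2 * j.val + 1, by omega⟩
  have ho (j) : (o j).val % 2 = 1 := by simp only [o]; omega
  have o_inj : Function.Injective o := by
    intro i j hij
    simp only [o, Fin.mk.injEq] at hij
    omega
  let S : Finset ℝ := Finset.univ.image (x ∘ o)
  have hcard : S.card = n := by
    rw [Finset.card_image_of_injective _ (hx.1.comp o_inj), Finset.card_univ, Fintype.card_fin]
  have hS : S.Nonempty := Finset.card_pos.1 (by omega)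
  have foot {r : ℝ} (hr : r ∈ S) : ∃ i : Fin (2 * n), i.val % 2 = 1 ∧ x i = r := by
    obtain ⟨j, -, rfl⟩ := Finset.mem_image.1 hr
    exact ⟨o j, ho j, rfl⟩
  obtain ⟨p, hp, q, hq, hpq⟩ := exists_lt_sub_of_four_spread hS hε (by
    intro i hi j hj k hk l hl
    obtain ⟨i, oi, rfl⟩ := foot hi
    obtain ⟨j, oj, rfl⟩ := foot hj
    obtain ⟨k, ok, rfl⟩ := foot hk
    obtain ⟨l, ol, rfl⟩ := foot hl
    exact hx.lt_of_four_odd oi oj ok ol)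
  obtain ⟨p, op, rfl⟩ := foot hp
  obtain ⟨q, oq, rfl⟩ := foot hq
  rw [hcard] at hpq
  exact hpq.trans_le (le_widthOf hε x op oq)

/-- Reversing the path and reflecting the plane in the line `y = x` exchanges vertical and
horizontal sticks. -/
theorem IsEpsPathRep.reflect {n : ℕ} {ε : ℝ} {x : Fin (2 * n) → ℝ}
    (hx : IsEpsPathRep n ε x) : IsEpsPathRep n ε (fun i => -x i.rev) := by
  refine ⟨fun i j hij => Fin.rev_injective (hx.1 (neg_injective hij)), fun i j hi hj => ?_⟩
  have h := hx.2 j.rev i.rev (by rw [Fin.val_rev]; omega) (by rw [Fin.val_rev]; omega)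
  rw [Fin.val_rev, Fin.val_rev] at h
  rw [neg_sub_neg, ← h]
  omega

theorem xCoords_reflect (n : ℕ) (ε : ℝ) (x : Fin (2 * n) → ℝ) :
    xCoords n ε (fun i => -x i.rev) = yCoords n ε x := by
  ext r
  simp only [xCoords, yCoords, Set.mem_ofPred_eq]
  rw [Fin.revPerm.surjective.exists]
  refine exists_congr fun i => ?_
  have h0 : i.rev.val % 2 = 0 ↔ i.val % 2 = 1 := by rw [Fin.val_rev]; omega
  have h1 : i.rev.val % 2 = 1 ↔ i.val % 2 = 0 := by rw [Fin.val_rev]; omega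
  simp only [Fin.revPerm_apply, Fin.rev_rev, h0, h1]
  exact or_comm

theorem widthOf_reflect (n : ℕ) (ε : ℝ) (x : Fin (2 * n) → ℝ) :
    widthOf n ε (fun i => -x i.rev) = heightOf n ε x := by
  rw [widthOf, heightOf, xCoords_reflect]

/-- Every stick representation of the `2n`-vertex `ε`-path has width strictly
greater than `n·ε/3` and height strictly greater than `n·ε/3`. -/
theorem epsPath_width_height_lower_bound (n : ℕ) (hn : 1 ≤ n) (ε : ℝ) (hε : 0 < ε)
    (x : Fin (2 * n) → ℝ) (hx : IsEpsPathRep n ε x) :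
    (n : ℝ) * ε / 3 < widthOf n ε x ∧ (n : ℝ) * ε / 3 < heightOf n ε x :=
  ⟨hx.lt_widthOf hn hε, widthOf_reflect n ε x ▸ hx.reflect.lt_widthOf hn hε⟩
end

section
/- Fix n ≥ 1, a partition of {1, …, n} into sets V (vertical) and H (horizontal), lengths ℓ_1, …, ℓ_n > 0, and a set E ⊆ V × H of edges such that every edge (j, i) ∈ E satisfies i < j. For all reals x_1 < x_2 < ⋯ < x_n, the full system holds if and only if the reduced system holds, where: the full system requires that for every j ∈ V and i ∈ H with i < j, (j,i) ∈ E implies x_j − x_i ≤ min(ℓ_i, ℓ_j) and (j,i) ∉ E implies x_j − x_i > min(ℓ_i, ℓ_j); and the reduced system requires only that (1) for every j ∈ V, if i is the smallest index with i < j, (j,i) ∈ E and ℓ_i ≥ ℓ_j, then x_j − x_i ≤ ℓ_j; (2) for every j ∈ V, if i is the largest index with i < j, i ∈ H, (j,i) ∉ E and ℓ_i ≥ ℓ_j, then x_j − x_i > ℓ_j; (3) for every i ∈ H, if j is the largest index with j > i, (j,i) ∈ E and ℓ_j > ℓ_i, then x_j − x_i ≤ ℓ_i; (4) for every i ∈ H,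 if j is the smallest index with j > i, j ∈ V, (j,i) ∉ E and ℓ_j > ℓ_i, then x_j − x_i > ℓ_i. In particular, the reduced system consists of at most 3n − 1 difference constraints (together with the ordering constraints) and is feasible exactly when the full system is. -/
/-- A nonempty set in a finite linear order has a least element. -/
theorem Set.Nonempty.exists_isLeast_of_finite {α : Type*} [LinearOrder α] [Finite α]
    {s : Set α} (hs : s.Nonempty) : ∃ a, IsLeast s a :=
  let ⟨a, ha, hmin⟩ := s.exists_min_image id s.toFinite hs
  ⟨a, ha, hmin⟩

/-- A nonempty set in a finite linear order has a greatest element. -/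
theorem Set.Nonempty.exists_isGreatest_of_finite {α : Type*} [LinearOrder α] [Finite α]
    {s : Set α} (hs : s.Nonempty) : ∃ a, IsGreatest s a :=
  let ⟨a, ha, hmax⟩ := s.exists_max_image id s.toFinite hs
  ⟨a, ha, hmax⟩

/-- Sticks are indexed `0, …, n-1` in their prescribed ground-line order, with `V`
the positions of vertical sticks, `H` the positions of horizontal sticks
(a partition of the positions), `ℓ i > 0` the fixed length of the `i`-th stick, and
`E j i` meaning that the vertical stick at position `j` and the horizontal stick at
position `i < j` are adjacent.  For strictly increasing foot coordinates `x`, the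
full system of difference constraints (expressing that vertical stick `j` and
horizontal stick `i` intersect iff `E j i`) is equivalent to the reduced system of
at most `3n − 1` difference constraints (1)–(4). -/
theorem full_system_iff_reduced_system (n : ℕ) (hn : 1 ≤ n)
    (V H : Finset (Fin n)) (hpart : ∀ i, i ∈ V ↔ i ∉ H)
    (ℓ : Fin n → ℝ) (hℓ : ∀ i, 0 < ℓ i)
    (E : Fin n → Fin n → Prop)
    (hE : ∀ j i, E j i → j ∈ V ∧ i ∈ H ∧ i < j)
    (x : Fin n → ℝ) (hx : StrictMono x) :
    -- full system
    (∀ j ∈ V, ∀ i ∈ H, i < j →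
        (E j i → x j - x i ≤ min (ℓ i) (ℓ j)) ∧
        (¬ E j i → min (ℓ i) (ℓ j) < x j - x i)) ↔
    -- reduced system
    ((∀ j ∈ V, ∀ i : Fin n,
        IsLeast {i' | i' < j ∧ E j i' ∧ ℓ j ≤ ℓ i'} i → x j - x i ≤ ℓ j) ∧
     (∀ j ∈ V, ∀ i : Fin n,
        IsGreatest {i' | i' < j ∧ i' ∈ H ∧ ¬ E j i' ∧ ℓ j ≤ ℓ i'} i →
          ℓ j < x j - x i) ∧
     (∀ i ∈ H, ∀ j : Fin n,
        IsGreatest {j' | i < j' ∧ E j' i ∧ ℓ i < ℓ j'} j → x j - x i ≤ ℓ i) ∧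
     (∀ i ∈ H, ∀ j : Fin n,
        IsLeast {j' | i < j' ∧ j' ∈ V ∧ ¬ E j' i ∧ ℓ i < ℓ j'} j →
          ℓ i < x j - x i)) := by
  constructor
  · intro h
    refine ⟨?_, ?_, ?_, ?_⟩
    · rintro j hj i ⟨⟨hij, he, -⟩, -⟩
      exact ((h j hj i (hE j i he).2.1 hij).1 he).trans (min_le_right _ _)
    · rintro j hj i ⟨⟨hij, hi, he, hl⟩, -⟩
      simpa [min_eq_right hl] using (h j hj i hi hij).2 he
    · rintro i hi j ⟨⟨hij, he, -⟩, -⟩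
      exact ((h j (hE j i he).1 i hi hij).1 he).trans (min_le_left _ _)
    · rintro i hi j ⟨⟨hij, hj, he, hl⟩, -⟩
      simpa [min_eq_left hl.le] using (h j hj i hi hij).2 he
  · rintro ⟨h1, h2, h3, h4⟩ j hj i hi hij
    rcases le_or_gt (ℓ j) (ℓ i) with hl | hl
    · rw [min_eq_right hl]
      refine ⟨fun he => ?_, fun he => ?_⟩
      · obtain ⟨a, ha⟩ := Set.Nonempty.exists_isLeast_of_finite
          (s := {i' | i' < j ∧ E j i' ∧ ℓ j ≤ ℓ i'}) ⟨i, hij, he, hl⟩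
        linarith [h1 j hj a ha, hx.monotone (ha.2 ⟨hij, he, hl⟩)]
      · obtain ⟨a, ha⟩ := Set.Nonempty.exists_isGreatest_of_finite
          (s := {i' | i' < j ∧ i' ∈ H ∧ ¬ E j i' ∧ ℓ j ≤ ℓ i'}) ⟨i, hij, hi, he, hl⟩
        linarith [h2 j hj a ha, hx.monotone (ha.2 ⟨hij, hi, he, hl⟩)]
    · rw [min_eq_left hl.le]
      refine ⟨fun he => ?_, fun he => ?_⟩
      · obtain ⟨a, ha⟩ := Set.Nonempty.exists_isGreatest_of_finite
          (s := {j' | i < j' ∧ E j' i ∧ ℓ i < ℓ j'}) ⟨j, hij, he, hl⟩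
        linarith [h3 i hi a ha, hx.monotone (ha.2 ⟨hij, he, hl⟩)]
      · obtain ⟨a, ha⟩ := Set.Nonempty.exists_isLeast_of_finite
          (s := {j' | i < j' ∧ j' ∈ V ∧ ¬ E j' i ∧ ℓ i < ℓ j'}) ⟨j, hij, hj, he, hl⟩
        linarith [h4 i hi a ha, hx.monotone (ha.2 ⟨hij, hj, he, hl⟩)]
end
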